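/- Let K be a field and λ ∈ K an element that is not a square in K (so that t² − λ is irreducible over K). Let V = K^7 and χ := [123] + λ·([156] + [345] + [426]) + [147], and set S := {u ∈ V : u_1 = u_4 = 0}. Then: (i) a nonzero u ∈ V is a pole of χ if and only if u ∈ S; (ii) dim Rad_χ(u) = 5 if and only if u is a nonzero multiple of e_7 (the unique pole of degree 4); (iii) for every pole p ∈ S with p ∉ span(e_7), Rad_χ(p) is a 3-dimensional subspace containing e_7, every 2-dimensional subspace of Rad_χ(p) lies in the upper radical R↑(χ), and for any two such poles p, q either Rad_χ(p) = Rad_χ(q) or Rad_χ(p) ∩ Rad_χ(q) = span(e_7) (so these planes induce a line spread of the quotient S/span(e_7)). -/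

import Mathlib

open Module

/-- The radical of a point `u` with respect to an alternating trilinear form `χ` on `V`:
the subspace `Rad_χ(u) = {v ∈ V | χ(u, v, x) = 0 for all x ∈ V}`. -/
def trilinRad {K V : Type*} [Field K] [AddCommGroup V] [Module K V]
    (χ : AlternatingMap K V K (Fin 3)) (u : V) : Submodule K V where
  carrier := {v | ∀ x : V, χ ![u, v, x] = 0}
  add_mem' := by
    intro a b ha hb x
    have h1 : (![u, a + b, x] : Fin 3 → V) = Function.update ![u, a, x] 1 (a + b) := by
      funext i; fin_cases i <;> simp
    have h2 : Function.update (![u, a, x] : Fin 3 → V) 1 a = ![u, a, x] := by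
      funext i; fin_cases i <;> simp
    have h3 : Function.update (![u, a, x] : Fin 3 → V) 1 b = ![u, b, x] := by
      funext i; fin_cases i <;> simp
    calc χ ![u, a + b, x]
        = χ (Function.update ![u, a, x] 1 (a + b)) := by rw [h1]
      _ = χ (Function.update ![u, a, x] 1 a) + χ (Function.update ![u, a, x] 1 b) := by
          rw [AlternatingMap.map_update_add]
      _ = 0 := by rw [h2, h3, ha x, hb x, add_zero]
  zero_mem' := by
    intro x
    exact AlternatingMap.map_coord_zero χ 1 (by simp)
  smul_mem' := by
    intro c a ha x
    have h1 : (![u, c • a, x] : Fin 3 → V) = Function.update ![u, a, x] 1 (c • a) := by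
      funext i; fin_cases i <;> simp
    have h2 : Function.update (![u, a, x] : Fin 3 → V) 1 a = ![u, a, x] := by
      funext i; fin_cases i <;> simp
    rw [h1, AlternatingMap.map_update_smul, h2, ha x, smul_zero]

/-- The basic alternating trilinear form `[ijk]` on `K^n`, sending `(x, y, z)` to the
determinant of the 3×3 matrix with rows `(x i, x j, x k)`, `(y i, y j, y k)`,
`(z i, z j, z k)`.  (Indices are 0-based: the form written `[123]` in the paper is
`trip 0 1 2`.) -/
noncomputable def trip {K : Type*} [Field K] {n : ℕ} (i j k : Fin n) :
    AlternatingMap K (Fin n → K) K (Fin 3) :=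
  (Matrix.detRowAlternating : AlternatingMap K (Fin 3 → K) K (Fin 3)).compLinearMap
    (LinearMap.funLeft K K ![i, j, k])

section LineSpreadForm

variable {K : Type*} [Field K] {lam : K}

/-- The form `[123] + λ([156] + [345] + [426]) + [147]`, in 0-based indices. -/
noncomputable def lineSpreadForm (lam : K) : AlternatingMap K (Fin 7 → K) K (Fin 3) :=
  trip 0 1 2 + lam • (trip 0 4 5 + trip 2 3 4 + trip 3 1 5) + trip 0 3 6

theorem trip_apply {n : ℕ} (i j k : Fin n) (x y z : Fin n → K) :
    trip i j k ![x, y, z] =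
      (x i * y j - x j * y i) * z k - (x i * y k - x k * y i) * z j
        + (x j * y k - x k * y j) * z i := by
  change Matrix.det (Matrix.of fun m => LinearMap.funLeft K K ![i, j, k] (![x, y, z] m)) = _
  rw [Matrix.det_fin_three]
  simp [LinearMap.funLeft_apply]
  ring

theorem lineSpreadForm_apply (u v x : Fin 7 → K) :
    lineSpreadForm lam ![u, v, x] =
      (u 1 * v 2 - u 2 * v 1 + lam * (u 4 * v 5 - u 5 * v 4) + (u 3 * v 6 - u 6 * v 3)) * x 0
      + (-(u 0 * v 2 - u 2 * v 0) - lam * (u 3 * v 5 - u 5 * v 3)) * x 1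
      + (u 0 * v 1 - u 1 * v 0 + lam * (u 3 * v 4 - u 4 * v 3)) * x 2
      + (lam * (u 1 * v 5 - u 5 * v 1 - (u 2 * v 4 - u 4 * v 2)) - (u 0 * v 6 - u 6 * v 0)) * x 3
      + lam * (u 2 * v 3 - u 3 * v 2 - (u 0 * v 5 - u 5 * v 0)) * x 4
      + lam * (u 0 * v 4 - u 4 * v 0 + (u 3 * v 1 - u 1 * v 3)) * x 5
      + (u 0 * v 3 - u 3 * v 0) * x 6 := by
  simp only [lineSpreadForm, AlternatingMap.add_apply, AlternatingMap.smul_apply, trip_apply,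
    smul_eq_mul]
  ring

theorem mem_trilinRad {V : Type*} [AddCommGroup V] [Module K V]
    {χ : AlternatingMap K V K (Fin 3)} {u v : V} :
    v ∈ trilinRad χ u ↔ ∀ x : V, χ ![u, v, x] = 0 :=
  Iff.rfl

theorem self_mem_trilinRad {V : Type*} [AddCommGroup V] [Module K V]
    (χ : AlternatingMap K V K (Fin 3)) (u : V) : u ∈ trilinRad χ u := fun x =>
  χ.map_eq_zero_of_eq ![u, u, x] (i := 0) (j := 1) rfl (by decide)

theorem mem_trilinRad_lineSpreadForm (hlam : lam ≠ 0) {u v : Fin 7 → K} :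
    v ∈ trilinRad (lineSpreadForm lam) u ↔
      u 1 * v 2 - u 2 * v 1 + lam * (u 4 * v 5 - u 5 * v 4) + (u 3 * v 6 - u 6 * v 3) = 0 ∧
      -(u 0 * v 2 - u 2 * v 0) - lam * (u 3 * v 5 - u 5 * v 3) = 0 ∧
      u 0 * v 1 - u 1 * v 0 + lam * (u 3 * v 4 - u 4 * v 3) = 0 ∧
      lam * (u 1 * v 5 - u 5 * v 1 - (u 2 * v 4 - u 4 * v 2)) - (u 0 * v 6 - u 6 * v 0) = 0 ∧
      u 2 * v 3 - u 3 * v 2 - (u 0 * v 5 - u 5 * v 0) = 0 ∧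
      u 0 * v 4 - u 4 * v 0 + (u 3 * v 1 - u 1 * v 3) = 0 ∧
      u 0 * v 3 - u 3 * v 0 = 0 := by
  rw [mem_trilinRad]
  constructor
  · intro h
    have key : ∀ i, lineSpreadForm lam ![u, v, Pi.single i 1] = 0 := fun i => h _
    refine ⟨?_, ?_, ?_, ?_, ?_, ?_, ?_⟩
    · simpa [lineSpreadForm_apply] using key 0
    · simpa [lineSpreadForm_apply] using key 1
    · simpa [lineSpreadForm_apply] using key 2
    · simpa [lineSpreadForm_apply] using key 3
    · simpa [lineSpreadForm_apply, hlam] using key 4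
    · simpa [lineSpreadForm_apply, hlam] using key 5
    · simpa [lineSpreadForm_apply] using key 6
  · rintro ⟨h0, h1, h2, h3, h4, h5, h6⟩ x
    rw [lineSpreadForm_apply, h0, h1, h2, h3, h4, h5, h6]
    ring

theorem ne_zero_of_not_square (hlam : ∀ x : K, x ^ 2 ≠ lam) : lam ≠ 0 := fun h =>
  hlam 0 (by simp [h])

theorem sq_sub_mul_sq_ne_zero (hlam : ∀ x : K, x ^ 2 ≠ lam) {x y : K} (h : ¬(x = 0 ∧ y = 0)) :
    x ^ 2 - lam * y ^ 2 ≠ 0 := by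
  intro h0
  have hy : y = 0 := by
    by_contra hy
    refine hlam (x / y) ?_
    field_simp
    linear_combination h0
  subst hy
  exact h ⟨by simpa using h0, rfl⟩

/-- The norm form of `K(√λ)` is anisotropic, so multiplication by `x + y√λ ≠ 0` is injective. -/
theorem eq_zero_of_mul_sqrt_eq_zero (hlam : ∀ x : K, x ^ 2 ≠ lam) {x y a b : K}
    (h : ¬(x = 0 ∧ y = 0)) (h₁ : x * a + lam * (y * b) = 0) (h₂ : y * a + x * b = 0) :
    a = 0 ∧ b = 0 := by
  have hN := sq_sub_mul_sq_ne_zero hlam h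
  constructor
  · exact (mul_eq_zero.mp (by linear_combination x * h₁ - lam * y * h₂ :
      (x ^ 2 - lam * y ^ 2) * a = 0)).resolve_left hN
  · exact (mul_eq_zero.mp (by linear_combination x * h₂ - y * h₁ :
      (x ^ 2 - lam * y ^ 2) * b = 0)).resolve_left hN

/-- Multiplication by `√λ` on `S / ⟨e₇⟩ ≅ K(√λ)²`. -/
def sqrtMul (lam : K) (p : Fin 7 → K) : Fin 7 → K :=
  ![0, lam * p 4, lam * p 5, 0, p 1, p 2, 0]

theorem mem_span_single_six {p : Fin 7 → K} :
    p ∈ Submodule.span K ({Pi.single (6 : Fin 7) (1 : K)} : Set (Fin 7 → K)) ↔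
      p 0 = 0 ∧ p 1 = 0 ∧ p 2 = 0 ∧ p 3 = 0 ∧ p 4 = 0 ∧ p 5 = 0 := by
  rw [Submodule.mem_span_singleton]
  constructor
  · rintro ⟨c, rfl⟩
    simp
  · rintro ⟨h0, h1, h2, h3, h4, h5⟩
    refine ⟨p 6, ?_⟩
    funext i
    fin_cases i <;> simp [*]

theorem trilinRad_eq_span_singleton (hlam : ∀ x : K, x ^ 2 ≠ lam) {u : Fin 7 → K}
    (hu : ¬(u 0 = 0 ∧ u 3 = 0)) :
    trilinRad (lineSpreadForm lam) u = Submodule.span K {u} := by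
  refine le_antisymm (fun v hv => ?_) ?_
  · obtain ⟨c, hc0, hc3⟩ : ∃ c : K, v 0 = c * u 0 ∧ v 3 = c * u 3 := by
      have h6 := ((mem_trilinRad_lineSpreadForm (ne_zero_of_not_square hlam)).mp hv).2.2.2.2.2.2
      by_cases h0 : u 0 = 0
      · have h3 : u 3 ≠ 0 := fun h3 => hu ⟨h0, h3⟩
        have hv0 : v 0 = 0 := by simpa [h0, h3] using h6
        exact ⟨v 3 / u 3, by simp [h0, hv0], by field_simp⟩
      · exact ⟨v 0 / u 0, by field_simp, by field_simp; linear_combination h6⟩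
    have hw := Submodule.sub_mem _ hv
      (Submodule.smul_mem _ c (self_mem_trilinRad (lineSpreadForm lam) u))
    generalize hwd : v - c • u = w at hw
    have hw0 : w 0 = 0 := by simp [← hwd, hc0]
    have hw3 : w 3 = 0 := by simp [← hwd, hc3]
    obtain ⟨h0, h1, h2, h3, h4, h5, -⟩ :=
      (mem_trilinRad_lineSpreadForm (ne_zero_of_not_square hlam)).mp hw
    simp only [hw0, hw3] at h0 h1 h2 h3 h4 h5
    obtain ⟨hw2, hw5⟩ := eq_zero_of_mul_sqrt_eq_zero hlam hu
      (by linear_combination -h1 : u 0 * w 2 + lam * (u 3 * w 5) = 0)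
      (by linear_combination -h4)
    obtain ⟨hw1, hw4⟩ := eq_zero_of_mul_sqrt_eq_zero hlam hu
      (by linear_combination h2 : u 0 * w 1 + lam * (u 3 * w 4) = 0)
      (by linear_combination h5)
    have hw6 : w 6 = 0 := by
      by_contra hw6
      refine hu ⟨?_, ?_⟩
      · simpa [hw1, hw2, hw4, hw5, hw6] using h3
      · simpa [hw1, hw2, hw4, hw5, hw6] using h0
    have hwz : w = 0 := by
      funext i
      fin_cases i <;> simp [*]
    rw [hwz, sub_eq_zero] at hwd
    exact Submodule.mem_span_singleton.mpr ⟨c, hwd.symm⟩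
  · rw [Submodule.span_singleton_le_iff_mem]
    exact self_mem_trilinRad _ u

theorem exists_coeff_of_cross_eq_zero (hlam : ∀ x : K, x ^ 2 ≠ lam) {a a' b b' c c' d d' : K}
    (h : ¬(a = 0 ∧ a' = 0)) (h₁ : a * d - b * c + lam * (a' * d' - b' * c') = 0)
    (h₂ : a * d' - b' * c - b * c' + a' * d = 0) :
    ∃ s t : K, c = s * a + t * (lam * a') ∧ c' = s * a' + t * a ∧
      d = s * b + t * (lam * b') ∧ d' = s * b' + t * b := by
  have hN := sq_sub_mul_sq_ne_zero hlam h
  refine ⟨(c * a - lam * c' * a') / (a ^ 2 - lam * a' ^ 2),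
    (c' * a - c * a') / (a ^ 2 - lam * a' ^ 2), ?_, ?_, ?_, ?_⟩
  · field_simp
    ring
  · field_simp
    ring
  · field_simp
    linear_combination a * h₁ - lam * a' * h₂
  · field_simp
    linear_combination a * h₂ - a' * h₁

theorem mem_trilinRad_iff_exists (hlam : ∀ x : K, x ^ 2 ≠ lam) {p v : Fin 7 → K}
    (hp0 : p 0 = 0) (hp3 : p 3 = 0)
    (hp : p ∉ Submodule.span K ({Pi.single (6 : Fin 7) (1 : K)} : Set (Fin 7 → K))) :
    v ∈ trilinRad (lineSpreadForm lam) p ↔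
      ∃ s t r : K, s • p + t • sqrtMul lam p + r • Pi.single (6 : Fin 7) (1 : K) = v := by
  have hl := ne_zero_of_not_square hlam
  rw [mem_trilinRad_lineSpreadForm hl]
  constructor
  · rintro ⟨h0, h1, h2, h3, h4, h5, -⟩
    simp only [hp0, hp3] at h0 h1 h2 h3 h4 h5
    obtain ⟨hv0, hv3⟩ : v 0 = 0 ∧ v 3 = 0 := by
      by_cases h14 : p 1 = 0 ∧ p 4 = 0
      · have h25 : ¬(p 2 = 0 ∧ p 5 = 0) := fun h25 =>
          hp (mem_span_single_six.mpr ⟨hp0, h14.1, h25.1, hp3, h14.2, h25.2⟩)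
        exact eq_zero_of_mul_sqrt_eq_zero hlam h25 (by linear_combination h1)
          (by linear_combination h4)
      · exact eq_zero_of_mul_sqrt_eq_zero hlam h14 (by linear_combination -h2)
          (by linear_combination -h5)
    simp only [hv0, hv3] at h0 h3
    have h3' : p 1 * v 5 - p 5 * v 1 - (p 2 * v 4 - p 4 * v 2) = 0 := by
      simpa [hl] using h3
    obtain ⟨s, t, e1, e4, e2, e5⟩ : ∃ s t : K, v 1 = s * p 1 + t * (lam * p 4) ∧
        v 4 = s * p 4 + t * p 1 ∧ v 2 = s * p 2 + t * (lam * p 5) ∧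
        v 5 = s * p 5 + t * p 2 := by
      by_cases h14 : p 1 = 0 ∧ p 4 = 0
      · have h25 : ¬(p 2 = 0 ∧ p 5 = 0) := fun h25 =>
          hp (mem_span_single_six.mpr ⟨hp0, h14.1, h25.1, hp3, h14.2, h25.2⟩)
        obtain ⟨s, t, e2, e5, e1, e4⟩ := exists_coeff_of_cross_eq_zero hlam h25
          (b := p 1) (b' := p 4) (c := v 2) (c' := v 5) (d := v 1) (d' := v 4)
          (by linear_combination -h0) (by linear_combination -h3')
        exact ⟨s, t, e1, e4, e2, e5⟩
      · exact exists_coeff_of_cross_eq_zero hlam h14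
          (by linear_combination h0) (by linear_combination h3')
    refine ⟨s, t, v 6 - s * p 6, ?_⟩
    funext i
    simp only [Pi.add_apply, Pi.smul_apply, smul_eq_mul]
    fin_cases i <;> simp [sqrtMul, *]
  · rintro ⟨s, t, r, rfl⟩
    simp only [sqrtMul, Pi.add_apply, Pi.smul_apply, smul_eq_mul]
    simp [hp0, hp3]
    constructor <;> [skip; right] <;> ring

theorem finrank_trilinRad_eq_three (hlam : ∀ x : K, x ^ 2 ≠ lam) {p : Fin 7 → K}
    (hp0 : p 0 = 0) (hp3 : p 3 = 0)
    (hp : p ∉ Submodule.span K ({Pi.single (6 : Fin 7) (1 : K)} : Set (Fin 7 → K))) :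
    finrank K (trilinRad (lineSpreadForm lam) p) = 3 := by
  let b : Fin 3 → Fin 7 → K := ![p, sqrtMul lam p, Pi.single (6 : Fin 7) (1 : K)]
  have hspan : trilinRad (lineSpreadForm lam) p = Submodule.span K (Set.range b) := by
    ext v
    rw [mem_trilinRad_iff_exists hlam hp0 hp3 hp, Submodule.mem_span_range_iff_exists_fun]
    constructor
    · rintro ⟨s, t, r, rfl⟩
      exact ⟨![s, t, r], by simp [b, Fin.sum_univ_three]⟩
    · rintro ⟨c, rfl⟩
      exact ⟨c 0, c 1, c 2, by simp [b, Fin.sum_univ_three]⟩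
  have hli : LinearIndependent K b := by
    rw [Fintype.linearIndependent_iff]
    intro c hc
    have hcoord : ∀ i, c 0 * p i + c 1 * sqrtMul lam p i
        + c 2 * (Pi.single (6 : Fin 7) (1 : K) : Fin 7 → K) i = 0 := fun i => by
      simpa [b, Fin.sum_univ_three] using congrFun hc i
    have h1 := hcoord 1
    have h2 := hcoord 2
    have h4 := hcoord 4
    have h5 := hcoord 5
    have h6 := hcoord 6
    simp [sqrtMul] at h1 h2 h4 h5 h6
    obtain ⟨hc0, hc1⟩ : c 0 = 0 ∧ c 1 = 0 := by
      by_cases h14 : p 1 = 0 ∧ p 4 = 0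
      · have h25 : ¬(p 2 = 0 ∧ p 5 = 0) := fun h25 =>
          hp (mem_span_single_six.mpr ⟨hp0, h14.1, h25.1, hp3, h14.2, h25.2⟩)
        exact eq_zero_of_mul_sqrt_eq_zero hlam h25 (by linear_combination h2)
          (by linear_combination h5)
      · exact eq_zero_of_mul_sqrt_eq_zero hlam h14 (by linear_combination h1)
          (by linear_combination h4)
    have hc2 : c 2 = 0 := by simpa [hc0] using h6
    intro i
    fin_cases i <;> assumption
  rw [hspan, finrank_span_eq_card hli, Fintype.card_fin]

theorem finrank_trilinRad_smul_single_six (hlam : lam ≠ 0) {c : K} (hc : c ≠ 0) :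
    finrank K (trilinRad (lineSpreadForm lam)
      (c • (Pi.single (6 : Fin 7) (1 : K) : Fin 7 → K))) = 5 := by
  have hker : trilinRad (lineSpreadForm lam) (c • (Pi.single (6 : Fin 7) (1 : K) : Fin 7 → K)) =
      LinearMap.ker (LinearMap.funLeft K K (![0, 3] : Fin 2 → Fin 7)) := by
    ext v
    rw [mem_trilinRad_lineSpreadForm hlam, LinearMap.mem_ker, funext_iff, Fin.forall_fin_two]
    simp [LinearMap.funLeft_apply, hc, and_comm]
  have hsurj : Function.Surjective (LinearMap.funLeft K K (![0, 3] : Fin 2 → Fin 7)) :=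
    LinearMap.funLeft_surjective_of_injective K K _ (by decide)
  have hrn := LinearMap.finrank_range_add_finrank_ker
    (LinearMap.funLeft K K (![0, 3] : Fin 2 → Fin 7))
  rw [LinearMap.range_eq_top.mpr hsurj, finrank_top, finrank_fin_fun, finrank_fin_fun] at hrn
  rw [hker]
  omega

theorem finrank_trilinRad_zero (χ : AlternatingMap K (Fin 7 → K) K (Fin 3)) :
    finrank K (trilinRad χ 0) = 7 := by
  have htop : trilinRad χ 0 = ⊤ :=
    eq_top_iff.mpr fun v _ x => χ.map_coord_zero (m := ![0, v, x]) 0 rfl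
  rw [htop, finrank_top, finrank_fin_fun]

theorem lineSpreadForm_eq_zero_of_mem_trilinRad (hlam : ∀ x : K, x ^ 2 ≠ lam) {p x y : Fin 7 → K}
    (hp0 : p 0 = 0) (hp3 : p 3 = 0)
    (hp : p ∉ Submodule.span K ({Pi.single (6 : Fin 7) (1 : K)} : Set (Fin 7 → K)))
    (hx : x ∈ trilinRad (lineSpreadForm lam) p) (hy : y ∈ trilinRad (lineSpreadForm lam) p)
    (u : Fin 7 → K) : lineSpreadForm lam ![u, x, y] = 0 := by
  obtain ⟨s, t, r, rfl⟩ := (mem_trilinRad_iff_exists hlam hp0 hp3 hp).mp hx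
  obtain ⟨s', t', r', rfl⟩ := (mem_trilinRad_iff_exists hlam hp0 hp3 hp).mp hy
  rw [lineSpreadForm_apply]
  simp only [Pi.add_apply, Pi.smul_apply, smul_eq_mul]
  simp [sqrtMul, hp0, hp3]
  ring

theorem trilinRad_eq_of_mem (hlam : ∀ x : K, x ^ 2 ≠ lam) {p v : Fin 7 → K}
    (hp0 : p 0 = 0) (hp3 : p 3 = 0)
    (hp : p ∉ Submodule.span K ({Pi.single (6 : Fin 7) (1 : K)} : Set (Fin 7 → K)))
    (hv : v ∈ trilinRad (lineSpreadForm lam) p)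
    (hv6 : v ∉ Submodule.span K ({Pi.single (6 : Fin 7) (1 : K)} : Set (Fin 7 → K))) :
    trilinRad (lineSpreadForm lam) p = trilinRad (lineSpreadForm lam) v := by
  have hv03 : v 0 = 0 ∧ v 3 = 0 := by
    obtain ⟨s, t, r, rfl⟩ := (mem_trilinRad_iff_exists hlam hp0 hp3 hp).mp hv
    simp only [Pi.add_apply, Pi.smul_apply, smul_eq_mul]
    simp [sqrtMul, hp0, hp3]
  refine Submodule.eq_of_le_of_finrank_eq (fun y hy x => ?_) ?_
  · have h := lineSpreadForm_eq_zero_of_mem_trilinRad hlam hp0 hp3 hp hv hy x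
    rw [lineSpreadForm_apply] at h ⊢
    linear_combination h
  · rw [finrank_trilinRad_eq_three hlam hp0 hp3 hp,
      finrank_trilinRad_eq_three hlam hv03.1 hv03.2 hv6]

theorem single_six_mem_trilinRad (hlam : lam ≠ 0) {p : Fin 7 → K} (hp0 : p 0 = 0)
    (hp3 : p 3 = 0) : Pi.single (6 : Fin 7) (1 : K) ∈ trilinRad (lineSpreadForm lam) p := by
  rw [mem_trilinRad_lineSpreadForm hlam]
  simp [hp0, hp3]

theorem trilinRad_eq_or_inf_eq (hlam : ∀ x : K, x ^ 2 ≠ lam) {p q : Fin 7 → K}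
    (hp0 : p 0 = 0) (hp3 : p 3 = 0)
    (hp : p ∉ Submodule.span K ({Pi.single (6 : Fin 7) (1 : K)} : Set (Fin 7 → K)))
    (hq0 : q 0 = 0) (hq3 : q 3 = 0)
    (hq : q ∉ Submodule.span K ({Pi.single (6 : Fin 7) (1 : K)} : Set (Fin 7 → K))) :
    trilinRad (lineSpreadForm lam) p = trilinRad (lineSpreadForm lam) q ∨
      trilinRad (lineSpreadForm lam) p ⊓ trilinRad (lineSpreadForm lam) q =
        Submodule.span K ({Pi.single (6 : Fin 7) (1 : K)} : Set (Fin 7 → K)) := by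
  have hl := ne_zero_of_not_square hlam
  refine or_iff_not_imp_left.mpr fun hne => le_antisymm ?_ ?_
  · rintro v ⟨hvp, hvq⟩
    by_contra hv
    exact hne ((trilinRad_eq_of_mem hlam hp0 hp3 hp hvp hv).trans
      (trilinRad_eq_of_mem hlam hq0 hq3 hq hvq hv).symm)
  · rw [Submodule.span_singleton_le_iff_mem]
    exact ⟨single_six_mem_trilinRad hl hp0 hp3, single_six_mem_trilinRad hl hq0 hq3⟩

theorem finrank_trilinRad_eq_one (hlam : ∀ x : K, x ^ 2 ≠ lam) {u : Fin 7 → K}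
    (hu : ¬(u 0 = 0 ∧ u 3 = 0)) : finrank K (trilinRad (lineSpreadForm lam) u) = 1 := by
  rw [trilinRad_eq_span_singleton hlam hu]
  exact finrank_span_singleton fun h => hu (by simp [h])

end LineSpreadForm

/-- for `λ` not a square in `K` and
`χ = [123] + λ([156] + [345] + [426]) + [147]` on `K^7`, with `S = {u | u₁ = u₄ = 0}`:
(i) a nonzero `u` is a pole iff `u ∈ S`;
(ii) `dim Rad_χ(u) = 5` iff `u` is a nonzero scalar multiple of `e₇`;
(iii) for every pole `p ∈ S` not in `span(e₇)`, `Rad_χ(p)` is a 3-dimensional subspace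
containing `e₇`, each of its 2-dimensional subspaces lies in the upper radical, and for
two such poles `p, q` the radicals either coincide or meet exactly in `span(e₇)`. -/
theorem stmt19 (K : Type*) [Field K] (lam : K) (hlam : ∀ x : K, x ^ 2 ≠ lam)
    (χ : AlternatingMap K (Fin 7 → K) K (Fin 3))
    (hχ : χ = trip 0 1 2 + lam • (trip 0 4 5 + trip 2 3 4 + trip 3 1 5) + trip 0 3 6) :
    (∀ u : Fin 7 → K, u ≠ 0 →
      (2 ≤ Module.finrank K (trilinRad χ u) ↔ (u 0 = 0 ∧ u 3 = 0))) ∧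
    (∀ u : Fin 7 → K,
      (Module.finrank K (trilinRad χ u) = 5 ↔
        ∃ c : K, c ≠ 0 ∧ u = c • (Pi.single (6 : Fin 7) (1 : K) : Fin 7 → K))) ∧
    (∀ p : Fin 7 → K, p ≠ 0 → p 0 = 0 → p 3 = 0 →
      p ∉ Submodule.span K ({Pi.single (6 : Fin 7) (1 : K)} : Set (Fin 7 → K)) →
      (Module.finrank K (trilinRad χ p) = 3 ∧
        Pi.single (6 : Fin 7) (1 : K) ∈ trilinRad χ p ∧
        (∀ ℓ : Submodule K (Fin 7 → K), ℓ ≤ trilinRad χ p → Module.finrank K ℓ = 2 →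
          ∀ u : Fin 7 → K, ∀ x ∈ ℓ, ∀ y ∈ ℓ, χ ![u, x, y] = 0) ∧
        (∀ q : Fin 7 → K, q ≠ 0 → q 0 = 0 → q 3 = 0 →
          q ∉ Submodule.span K ({Pi.single (6 : Fin 7) (1 : K)} : Set (Fin 7 → K)) →
          (trilinRad χ p = trilinRad χ q ∨
            trilinRad χ p ⊓ trilinRad χ q =
              Submodule.span K ({Pi.single (6 : Fin 7) (1 : K)} : Set (Fin 7 → K)))))) := by
  obtain rfl : χ = lineSpreadForm lam := hχ
  have hl := ne_zero_of_not_square hlam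
  have exists_smul : ∀ u : Fin 7 → K, u ≠ 0 →
      u ∈ Submodule.span K ({Pi.single (6 : Fin 7) (1 : K)} : Set (Fin 7 → K)) →
      ∃ c : K, c ≠ 0 ∧ u = c • (Pi.single (6 : Fin 7) (1 : K) : Fin 7 → K) := by
    intro u hu hmem
    obtain ⟨c, rfl⟩ := Submodule.mem_span_singleton.mp hmem
    exact ⟨c, fun hc => hu (by simp [hc]), rfl⟩
  refine ⟨fun u hu => ⟨fun h => ?_, fun h => ?_⟩, fun u => ⟨fun h => ?_, ?_⟩,
    fun p _ hp0 hp3 hp => ⟨finrank_trilinRad_eq_three hlam hp0 hp3 hp,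
      single_six_mem_trilinRad hl hp0 hp3,
      fun ℓ hℓ _ u x hx y hy =>
        lineSpreadForm_eq_zero_of_mem_trilinRad hlam hp0 hp3 hp (hℓ hx) (hℓ hy) u,
      fun q _ hq0 hq3 hq => trilinRad_eq_or_inf_eq hlam hp0 hp3 hp hq0 hq3 hq⟩⟩
  · by_contra hS
    rw [finrank_trilinRad_eq_one hlam hS] at h
    omega
  · by_cases hmem : u ∈ Submodule.span K ({Pi.single (6 : Fin 7) (1 : K)} : Set (Fin 7 → K))
    · obtain ⟨c, hc, rfl⟩ := exists_smul u hu hmem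
      rw [finrank_trilinRad_smul_single_six hl hc]
      omega
    · rw [finrank_trilinRad_eq_three hlam h.1 h.2 hmem]
      omega
  · have hu : u ≠ 0 := by
      rintro rfl
      rw [finrank_trilinRad_zero] at h
      omega
    refine exists_smul u hu ?_
    by_contra hmem
    by_cases hS : u 0 = 0 ∧ u 3 = 0
    · rw [finrank_trilinRad_eq_three hlam hS.1 hS.2 hmem] at h
      omega
    · rw [finrank_trilinRad_eq_one hlam hS] at h
      omega
  · rintro ⟨c, hc, rfl⟩
    exact finrank_trilinRad_smul_single_six hl hc
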